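/- Let Q = q = p^r, let s be a positive divisor of r, assume p divides N_j for every j ∉ J, and let t ≤ n_J be a positive integer. For an exponent tuple b with 0 ≤ b_j ≤ N_j − 1 for all j, define μ(b) by: μ(b)_j = 0 if b_j = 0, and otherwise μ(b)_j is the unique c ∈ {1,…,N_j − 1} with c ≡ p^s·b_j (mod N_j − 1); the cyclotomic set of b is I_b = { μ^i(b) : i ≥ 0 }. Put Δ = ∪_{b ∈ N(J,t)} I_b, and assume there is no pair (c, c') of elements of Δ such that c_j + c'_j ≡ 0 (mod N_j − 1) for all j and c_j + c'_j > 0 for all j ∉ J. Let E_Δ ⊆ F_q^{n_J} be the F_q-span of { ev_J(X^b) : b ∈ Δ } and C = E_Δ ∩ F_{p^s}^{n_J} its subfield-subcode. Then C ⊆ C^⊥ (Euclidean duality on F_{p^s}^{n_J}), dim_{F_{p^s}} C = card(Δ), and every nonzero codeword of C^⊥ has Hamming weight at least t. -/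

import Mathlib

/-- `ε_j = 1` if `j ∈ J` and `0` otherwise. -/
def eps {m : ℕ} (J : Finset (Fin m)) (j : Fin m) : ℕ := if j ∈ J then 1 else 0

/-- The points `Z_J` of the `J`-affine variety. -/
def ZJ (F : Type) [Field F] [Fintype F] [DecidableEq F] {m : ℕ} (N : Fin m → ℕ)
    (J : Finset (Fin m)) : Finset (Fin m → F) :=
  Finset.univ.filter
    (fun x => ∀ j, (j ∈ J → x j ^ (N j - 1) = 1) ∧ (j ∉ J → x j ^ (N j) = x j))

/-- Evaluation of the monomial `X^b` at all the points of `Z_J`. -/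
def evm (F : Type) [Field F] [Fintype F] [DecidableEq F] {m : ℕ} (N : Fin m → ℕ)
    (J : Finset (Fin m)) (b : Fin m → ℕ) : ↥(ZJ F N J) → F :=
  fun P => ∏ j, P.1 j ^ b j

/-- The set `N(J,t)` of exponent tuples. -/
def NSet {m : ℕ} (N : Fin m → ℕ) (J : Finset (Fin m)) (t : ℕ) : Set (Fin m → ℕ) :=
  { b | (∀ j, eps J j ≤ b j ∧ b j ≤ N j - 1) ∧ ∏ j, (b j + 1 - eps J j) < t }

/-- The code `F(J,t)`: the span of the evaluations of the monomials with exponents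
in `N(J,t)`. -/
noncomputable def Fcode (F : Type) [Field F] [Fintype F] [DecidableEq F] {m : ℕ}
    (N : Fin m → ℕ) (J : Finset (Fin m)) (t : ℕ) : Submodule F (↥(ZJ F N J) → F) :=
  Submodule.span F { v | ∃ b ∈ NSet N J t, v = evm F N J b }

/-- The map `μ`: multiply each nonzero coordinate by `b₀` modulo `N_j - 1`, taking the
representative in `{1, …, N_j - 1}` (and fixing zero coordinates). -/
def muMap (b₀ : ℕ) {m : ℕ} (N : Fin m → ℕ) (b : Fin m → ℕ) : Fin m → ℕ :=
  fun j => if b j = 0 then 0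
    else if (b₀ * b j) % (N j - 1) = 0 then N j - 1 else (b₀ * b j) % (N j - 1)

/-- The closure `Δ = ∪_{b ∈ N(J,t)} I_b` of `N(J,t)` under `μ` (for `b₀ = p^s`). -/
def DeltaSet (b₀ : ℕ) {m : ℕ} (N : Fin m → ℕ) (J : Finset (Fin m)) (t : ℕ) :
    Set (Fin m → ℕ) :=
  { c | ∃ b ∈ NSet N J t, ∃ i : ℕ, (muMap b₀ N)^[i] b = c }

/-- The code `E_Δ`: the span of the evaluations of the monomials with exponents in `Δ`. -/
noncomputable def EDelta (F : Type) [Field F] [Fintype F] [DecidableEq F] {m : ℕ}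
    (b₀ : ℕ) (N : Fin m → ℕ) (J : Finset (Fin m)) (t : ℕ) :
    Submodule F (↥(ZJ F N J) → F) :=
  Submodule.span F { v | ∃ c ∈ DeltaSet b₀ N J t, v = evm F N J c }

/-- The subfield-subcode `E_Δ ∩ F_{q₀}^{n_J}`, the subfield being `{x : x ^ q₀ = x}`. -/
noncomputable def sfcDelta (F : Type) [Field F] [Fintype F] [DecidableEq F] {m : ℕ}
    (b₀ q₀ : ℕ) (N : Fin m → ℕ) (J : Finset (Fin m)) (t : ℕ) :
    Set (↥(ZJ F N J) → F) :=
  { v | v ∈ EDelta F b₀ N J t ∧ ∀ i, v i ^ q₀ = v i }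

/-- Evaluation of the monomial `X^b` at a family of points. -/
def monomialEval {F : Type*} [CommSemiring F] {ι : Type*} {m : ℕ} (pt : ι → Fin m → F)
    (b : Fin m → ℕ) : ι → F :=
  fun i => ∏ j, pt i j ^ b j

theorem monomialEval_add {F : Type*} [CommSemiring F] {ι : Type*} {m : ℕ}
    (pt : ι → Fin m → F) (b c : Fin m → ℕ) :
    monomialEval pt (b + c) = monomialEval pt b * monomialEval pt c := by
  ext i
  simp [monomialEval, pow_add, Finset.prod_mul_distrib]

/-- The lexicographically standard exponents of a family of points: those whose monomial is not,
as a function on the points, a combination of smaller monomials. -/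
def IsStandardExponent {F : Type*} [Field F] {ι : Type*} {m : ℕ} (pt : ι → Fin m → F)
    (b : Fin m → ℕ) : Prop :=
  monomialEval pt b ∉ Submodule.span F (monomialEval pt '' {c | toLex c < toLex b})

theorem IsStandardExponent.mono {F : Type*} [Field F] {ι : Type*} {m : ℕ}
    {pt : ι → Fin m → F} {b c : Fin m → ℕ} (hb : IsStandardExponent pt b) (hcb : c ≤ b) :
    IsStandardExponent pt c := by
  intro hc
  apply hb
  have hbc : c + (b - c) = b := add_tsub_cancel_of_le hcb
  rw [← hbc, monomialEval_add]
  have key : Submodule.span F (monomialEval pt '' {d | toLex d < toLex c}) ≤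
      (Submodule.span F (monomialEval pt '' {d | toLex d < toLex (c + (b - c))})).comap
        (LinearMap.mulRight F (monomialEval pt (b - c))) := by
    rw [Submodule.span_le]
    rintro _ ⟨d, hd, rfl⟩
    refine Submodule.subset_span ⟨d + (b - c), ?_, ?_⟩
    · have hd' : toLex d < toLex c := hd
      change toLex d + toLex (b - c) < toLex c + toLex (b - c)
      gcongr
    · simp [monomialEval_add]
  exact key hc

theorem linearIndependent_isStandardExponent {F : Type*} [Field F] {ι : Type*} {m : ℕ}
    (pt : ι → Fin m → F) :
    LinearIndependent F
      (fun b : {b : Fin m → ℕ // IsStandardExponent pt b} => monomialEval pt b.1) := by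
  classical
  rw [linearIndependent_iff']
  intro s g hg
  by_contra! hne
  obtain ⟨i, his, hi⟩ := hne
  obtain ⟨b, hb, hmax⟩ := (s.filter (fun c => g c ≠ 0)).exists_max_image (fun c => toLex c.1)
    ⟨i, by simp [his, hi]⟩
  simp only [Finset.mem_filter] at hb hmax
  apply b.2
  rw [← Finset.add_sum_erase _ _ hb.1] at hg
  have : monomialEval pt b.1 =
      -((g b)⁻¹ • ∑ x ∈ s.erase b, g x • monomialEval pt x.1) := by
    rw [← eq_neg_iff_add_eq_zero] at hg
    rw [← smul_neg, ← hg, smul_smul, inv_mul_cancel₀ hb.2, one_smul]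
  rw [this]
  refine neg_mem (Submodule.smul_mem _ _ (Submodule.sum_mem _ fun x hx => ?_))
  rw [Finset.mem_erase] at hx
  by_cases hgx : g x = 0
  · simp [hgx]
  · refine Submodule.smul_mem _ _ (Submodule.subset_span ⟨x.1, ?_, rfl⟩)
    refine lt_of_le_of_ne (hmax x ⟨hx.2, hgx⟩) fun h => hx.1 (Subtype.ext (toLex.injective h))

theorem monomialEval_mem_span_isStandardExponent {F : Type*} [Field F] {ι : Type*} {m : ℕ}
    (pt : ι → Fin m → F) (b : Fin m → ℕ) :
    monomialEval pt b ∈ Submodule.span F (monomialEval pt '' {c | IsStandardExponent pt c}) := by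
  suffices H : ∀ b : Lex (Fin m → ℕ), monomialEval pt (ofLex b) ∈
      Submodule.span F (monomialEval pt '' {c | IsStandardExponent pt c}) from H (toLex b)
  intro b
  induction b using WellFoundedLT.induction with
  | ind b ih =>
    by_cases hb : IsStandardExponent pt (ofLex b)
    · exact Submodule.subset_span ⟨_, hb, rfl⟩
    · rw [IsStandardExponent, not_not] at hb
      refine Submodule.span_le.2 ?_ hb
      rintro _ ⟨c, hc, rfl⟩
      exact ih (toLex c) hc

theorem span_range_monomialEval {F : Type*} [Field F] [Finite F] {ι : Type*} [Finite ι] {m : ℕ}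
    {pt : ι → Fin m → F} (hpt : Function.Injective pt) :
    Submodule.span F (Set.range (monomialEval pt)) = ⊤ := by
  classical
  have := Fintype.ofFinite F
  have := Fintype.ofFinite ι
  rw [eq_top_iff]
  intro v _
  have hv : v = ∑ i, v i • fun k => MvPolynomial.eval (pt k) (MvPolynomial.indicator (pt i)) := by
    ext k
    simp only [Finset.sum_apply, Pi.smul_apply, smul_eq_mul]
    rw [Finset.sum_eq_single k]
    · rw [MvPolynomial.eval_indicator_apply_eq_one, mul_one]
    · intro i _ hik
      rw [MvPolynomial.eval_indicator_apply_eq_zero _ _ (hpt.ne hik.symm), mul_zero]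
    · simp
  rw [hv]
  refine Submodule.sum_mem _ fun i _ => Submodule.smul_mem _ _ ?_
  have (P : MvPolynomial (Fin m) F) : (fun k => MvPolynomial.eval (pt k) P) =
      ∑ d ∈ P.support, P.coeff d • monomialEval pt d := by
    ext k
    simp [MvPolynomial.eval_eq', monomialEval]
  rw [this]
  exact Submodule.sum_mem _ fun d _ => Submodule.smul_mem _ _ (Submodule.subset_span ⟨d, rfl⟩)

theorem span_isStandardExponent {F : Type*} [Field F] [Finite F] {ι : Type*} [Finite ι] {m : ℕ}
    {pt : ι → Fin m → F} (hpt : Function.Injective pt) :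
    Submodule.span F (monomialEval pt '' {c | IsStandardExponent pt c}) = ⊤ := by
  rw [eq_top_iff, ← span_range_monomialEval hpt, Submodule.span_le]
  rintro _ ⟨b, rfl⟩
  exact monomialEval_mem_span_isStandardExponent pt b

theorem IsStandardExponent.prod_le_card {F : Type*} [Field F] {ι : Type*} [Fintype ι] {m : ℕ}
    {pt : ι → Fin m → F} {b : Fin m → ℕ} (hb : IsStandardExponent pt b) :
    ∏ j, (b j + 1) ≤ Fintype.card ι := by
  have hli := (linearIndependent_isStandardExponent pt).comp
    (fun c : ↥(Finset.Icc 0 b) => ⟨c.1, hb.mono (Finset.mem_Icc.1 c.2).2⟩)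
    (fun c d h => Subtype.ext (congrArg (fun e => e.1) h))
  have := hli.fintype_card_le_finrank
  rw [Module.finrank_pi, Fintype.card_coe] at this
  simpa [Pi.card_Icc] using this

theorem IsStandardExponent.lt_of_pow_eq {F : Type*} [Field F] {ι : Type*} {m : ℕ}
    {pt : ι → Fin m → F} {b : Fin m → ℕ} (hb : IsStandardExponent pt b) {j : Fin m} {k l : ℕ}
    (hlk : l < k) (h : ∀ i, pt i j ^ k = pt i j ^ l) : b j < k := by
  by_contra! hk
  refine hb (Submodule.subset_span ⟨Function.update b j (b j - k + l), ?_, ?_⟩)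
  · exact Pi.toLex_update_lt_self_iff.2 (by omega)
  · ext i
    refine Finset.prod_congr rfl fun j' _ => ?_
    by_cases hj : j' = j
    · subst hj
      rw [Function.update_self, pow_add, ← h, ← pow_add, Nat.sub_add_cancel hk]
    · rw [Function.update_of_ne hj]

theorem exists_isPrimitiveRoot_of_dvd_card_sub_one (F : Type*) [Field F] [Fintype F] {n : ℕ}
    (hn : n ∣ Fintype.card F - 1) : ∃ ζ : F, IsPrimitiveRoot ζ n := by
  classical
  obtain ⟨g, hg⟩ := IsCyclic.exists_ofOrder_eq_natCard (α := Fˣ)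
  rw [Nat.card_eq_fintype_card, Fintype.card_units] at hg
  obtain ⟨d, hd⟩ := hn
  have hpos : 0 < Fintype.card F - 1 := Nat.sub_pos_of_lt Fintype.one_lt_card
  have hg' : IsPrimitiveRoot g (Fintype.card F - 1) := hg ▸ IsPrimitiveRoot.orderOf g
  exact ⟨_, IsPrimitiveRoot.coe_units_iff.2 (hg'.pow hpos (by rw [hd, mul_comm]))⟩

theorem card_filter_pow_eq_one {F : Type*} [Field F] [Fintype F] [DecidableEq F] {n : ℕ}
    (hn : n ∣ Fintype.card F - 1) :
    (Finset.univ.filter fun x : F => x ^ n = 1).card = n := by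
  obtain ⟨ζ, hζ⟩ := exists_isPrimitiveRoot_of_dvd_card_sub_one F hn
  have hpos : 0 < n :=
    Nat.pos_of_dvd_of_pos hn (Nat.sub_pos_of_lt Fintype.one_lt_card)
  refine Eq.trans (congrArg Finset.card ?_) hζ.card_nthRootsFinset
  ext x
  simp [Polynomial.mem_nthRootsFinset hpos]

theorem filter_pow_eq_self {F : Type*} [Field F] [Fintype F] [DecidableEq F] {n : ℕ}
    (hn : 1 < n) :
    (Finset.univ.filter fun x : F => x ^ n = x) =
      insert 0 (Finset.univ.filter fun x : F => x ^ (n - 1) = 1) := by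
  ext x
  obtain ⟨k, rfl⟩ : ∃ k, n = k + 2 := ⟨n - 2, by omega⟩
  by_cases hx : x = 0
  · simp [hx]
  · simp [hx, pow_succ _ (k + 1)]

theorem card_filter_pow_eq_self {F : Type*} [Field F] [Fintype F] [DecidableEq F] {n : ℕ}
    (hn : 1 < n) (hdvd : n - 1 ∣ Fintype.card F - 1) :
    (Finset.univ.filter fun x : F => x ^ n = x).card = n := by
  rw [filter_pow_eq_self hn, Finset.card_insert_of_notMem, card_filter_pow_eq_one hdvd]
  · omega
  · simp [show n - 1 ≠ 0 by omega]

/-- The set of possible values of the `j`-th coordinate of a point of `Z_J`. -/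
def coordSet (F : Type) [Field F] [Fintype F] [DecidableEq F] {m : ℕ} (N : Fin m → ℕ)
    (J : Finset (Fin m)) (j : Fin m) : Finset F :=
  Finset.univ.filter fun x => (j ∈ J → x ^ (N j - 1) = 1) ∧ (j ∉ J → x ^ (N j) = x)

theorem ZJ_eq_piFinset (F : Type) [Field F] [Fintype F] [DecidableEq F] {m : ℕ} (N : Fin m → ℕ)
    (J : Finset (Fin m)) : ZJ F N J = Fintype.piFinset (coordSet F N J) := by
  ext x
  simp [ZJ, coordSet]

theorem card_coordSet (F : Type) [Field F] [Fintype F] [DecidableEq F] {m : ℕ} {N : Fin m → ℕ}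
    (J : Finset (Fin m)) {j : Fin m} (hN : 1 < N j) (hdvd : N j - 1 ∣ Fintype.card F - 1) :
    (coordSet F N J j).card = N j - eps J j := by
  by_cases hj : j ∈ J
  · simpa [coordSet, eps, hj] using card_filter_pow_eq_one hdvd
  · simpa [coordSet, eps, hj] using card_filter_pow_eq_self hN hdvd

theorem card_ZJ (F : Type) [Field F] [Fintype F] [DecidableEq F] {m : ℕ} {N : Fin m → ℕ}
    (J : Finset (Fin m)) (hN : ∀ j, 1 < N j) (hdvd : ∀ j, N j - 1 ∣ Fintype.card F - 1) :
    (ZJ F N J).card = ∏ j, (N j - eps J j) := by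
  rw [ZJ_eq_piFinset, Fintype.card_piFinset]
  exact Finset.prod_congr rfl fun j _ => card_coordSet F J (hN j) (hdvd j)

theorem mul_mem_coordSet {F : Type} [Field F] [Fintype F] [DecidableEq F] {m : ℕ}
    {N : Fin m → ℕ} {J : Finset (Fin m)} {j : Fin m} (hN : 1 < N j) {ζ : F}
    (hζ : ζ ^ (N j - 1) = 1) {x : F} (hx : x ∈ coordSet F N J j) :
    ζ * x ∈ coordSet F N J j := by
  have h1 : ζ ^ N j = ζ := by
    rw [← Nat.sub_add_cancel hN.le, pow_succ, hζ, one_mul]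
  simp only [coordSet, Finset.mem_filter, Finset.mem_univ, true_and] at hx ⊢
  exact ⟨fun h => by rw [mul_pow, hζ, hx.1 h, one_mul], fun h => by rw [mul_pow, h1, hx.2 h]⟩

theorem sum_coordSet_pow_of_not_dvd {F : Type} [Field F] [Fintype F] [DecidableEq F] {m : ℕ}
    {N : Fin m → ℕ} (J : Finset (Fin m)) {j : Fin m} (hN : 1 < N j)
    (hdvd : N j - 1 ∣ Fintype.card F - 1) {e : ℕ} (he : ¬ N j - 1 ∣ e) :
    ∑ x ∈ coordSet F N J j, x ^ e = 0 := by
  obtain ⟨ζ, hζ⟩ := exists_isPrimitiveRoot_of_dvd_card_sub_one F hdvd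
  have hζ0 : ζ ≠ 0 := hζ.ne_zero (by omega)
  have hinv : ζ⁻¹ ^ (N j - 1) = 1 := by rw [inv_pow, hζ.pow_eq_one, inv_one]
  have hsum : ∑ x ∈ coordSet F N J j, x ^ e = ζ ^ e * ∑ x ∈ coordSet F N J j, x ^ e := by
    rw [Finset.mul_sum]
    refine Finset.sum_bij' (fun x _ => ζ⁻¹ * x) (fun x _ => ζ * x)
      (fun x hx => mul_mem_coordSet hN hinv hx)
      (fun x hx => mul_mem_coordSet hN hζ.pow_eq_one hx) ?_ ?_ ?_
    · intro x _
      rw [mul_inv_cancel_left₀ hζ0]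
    · intro x _
      rw [inv_mul_cancel_left₀ hζ0]
    · intro x _
      rw [← mul_pow, mul_inv_cancel_left₀ hζ0]
  have hne : ζ ^ e ≠ 1 := fun h => he ((hζ.pow_eq_one_iff_dvd e).1 h)
  by_contra h0
  exact hne (mul_right_cancel₀ h0 (by rw [one_mul]; exact hsum.symm))

theorem sum_evm_mul_evm {F : Type} [Field F] [Fintype F] [DecidableEq F] {m : ℕ}
    (N : Fin m → ℕ) (J : Finset (Fin m)) (c c' : Fin m → ℕ) :
    ∑ i, evm F N J c i * evm F N J c' i = ∏ j, ∑ x ∈ coordSet F N J j, x ^ (c j + c' j) := by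
  rw [Finset.prod_univ_sum, ← ZJ_eq_piFinset, ← Finset.sum_coe_sort (ZJ F N J)]
  simp [evm, pow_add, Finset.prod_mul_distrib]

theorem sum_evm_mul_evm_eq_zero {F : Type} [Field F] [Fintype F] [DecidableEq F] {m p : ℕ}
    [CharP F p] {N : Fin m → ℕ} {J : Finset (Fin m)} (hN : ∀ j, 1 < N j)
    (hdvd : ∀ j, N j - 1 ∣ Fintype.card F - 1) (hpN : ∀ j ∉ J, p ∣ N j) {c c' : Fin m → ℕ}
    (h : ¬ ((∀ j, (N j - 1) ∣ (c j + c' j)) ∧ ∀ j ∉ J, 0 < c j + c' j)) :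
    ∑ i, evm F N J c i * evm F N J c' i = 0 := by
  rw [sum_evm_mul_evm, Finset.prod_eq_zero_iff]
  rw [not_and_or] at h
  rcases h with h | h
  · push Not at h
    obtain ⟨j, hj⟩ := h
    exact ⟨j, Finset.mem_univ _, sum_coordSet_pow_of_not_dvd J (hN j) (hdvd j) hj⟩
  · push Not at h
    obtain ⟨j, hj, h0⟩ := h
    refine ⟨j, Finset.mem_univ _, ?_⟩
    rw [Nat.le_zero.1 h0]
    simp only [pow_zero, Finset.sum_const, nsmul_eq_mul, mul_one]
    rw [card_coordSet F J (hN j) (hdvd j), CharP.cast_eq_zero_iff F p]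
    simpa [eps, hj] using hpN j hj

theorem RingHom.pow_apply_of_apply_eq_pow {F : Type*} [CommSemiring F] {φ : F →+* F} {q : ℕ}
    (hφ : ∀ x, φ x = x ^ q) (i : ℕ) (x : F) : (φ ^ i) x = x ^ q ^ i := by
  induction i with
  | zero => simp
  | succ i ih => rw [pow_succ', RingHom.mul_def, RingHom.comp_apply, ih, hφ, ← pow_mul, pow_succ]

/-- The trace of the extension of degree `d` with Galois group generated by `φ`. -/
def cyclicTrace {F : Type*} [CommSemiring F] (φ : F →+* F) (d : ℕ) (x : F) : F :=
  ∑ i ∈ Finset.range d, (φ ^ i) x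

theorem map_cyclicTrace {F : Type*} [Field F] [Fintype F] {φ : F →+* F} {q d : ℕ}
    (hφ : ∀ x, φ x = x ^ q) (hcard : Fintype.card F = q ^ d) (x : F) :
    φ (cyclicTrace φ d x) = cyclicTrace φ d x := by
  have h : ∀ i, φ ((φ ^ i) x) = (φ ^ (i + 1)) x := fun i => by
    rw [pow_succ', RingHom.mul_def, RingHom.comp_apply]
  have hd : (φ ^ d) x = (φ ^ 0) x := by
    rw [RingHom.pow_apply_of_apply_eq_pow hφ, ← hcard, FiniteField.pow_card, pow_zero]
    rfl
  rw [cyclicTrace, map_sum]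
  simp_rw [h]
  have := Finset.sum_range_succ (fun i => (φ ^ i) x) d
  rw [Finset.sum_range_succ', hd] at this
  exact add_right_cancel this

/-- Independence of the powers of a Frobenius map, as characters of the additive group. -/
theorem eq_zero_of_forall_sum_frobenius_mul {F : Type*} [Field F] [Fintype F] {φ : F →+* F}
    {q d : ℕ} (hφ : ∀ x, φ x = x ^ q) (hq : 1 < q) (hcard : Fintype.card F = q ^ d)
    {c : ℕ → F} (h : ∀ x : F, ∑ i ∈ Finset.range d, (φ ^ i) x * c i = 0) {i : ℕ} (hi : i < d) :
    c i = 0 := by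
  classical
  let P : Polynomial F :=
    ∑ k ∈ Finset.range d, Polynomial.C (c k) * Polynomial.X ^ q ^ k
  have hP : P = 0 := by
    apply Polynomial.eq_zero_of_natDegree_lt_card_of_eval_eq_zero P Function.injective_id
    · intro x
      rw [← h x, Polynomial.eval_finsetSum]
      refine Finset.sum_congr rfl fun k _ => ?_
      rw [RingHom.pow_apply_of_apply_eq_pow hφ, Polynomial.eval_C_mul, Polynomial.eval_X_pow,
        id, mul_comm]
    · rw [hcard]
      refine Nat.lt_of_le_pred (by positivity) ?_
      refine Polynomial.natDegree_sum_le_of_forall_le _ _ fun k hk => ?_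
      refine (Polynomial.natDegree_C_mul_X_pow_le _ _).trans (Nat.le_pred_of_lt ?_)
      exact Nat.pow_lt_pow_right hq (Finset.mem_range.1 hk)
  have hc : P.coeff (q ^ i) = c i := by
    simp only [P, Polynomial.finsetSum_coeff, Polynomial.coeff_C_mul, Polynomial.coeff_X_pow]
    rw [Finset.sum_eq_single i]
    · simp
    · intro k _ hk
      rw [if_neg fun h => hk (Nat.pow_right_injective hq h.symm), mul_zero]
    · intro h
      exact absurd (Finset.mem_range.2 hi) h
  rw [← hc, hP, Polynomial.coeff_zero]

theorem pow_comp_mem_of_comp_mem {F ι : Type*} [Field F] {φ : F →+* F}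
    {V : Submodule F (ι → F)} (hV : ∀ v ∈ V, φ ∘ v ∈ V) (i : ℕ) {v : ι → F} (hv : v ∈ V) :
    (φ ^ i : F →+* F) ∘ v ∈ V := by
  induction i with
  | zero => exact hv
  | succ i ih =>
    rw [pow_succ', RingHom.mul_def, RingHom.coe_comp, Function.comp_assoc]
    exact hV _ ih

/-- A linear functional vanishing on the fixed vectors of a Frobenius-stable subspace vanishes on
the whole subspace. -/
theorem apply_eq_zero_of_forall_fixed {F ι : Type*} [Field F] [Fintype F] {φ : F →+* F}
    {q d : ℕ} (hφ : ∀ x, φ x = x ^ q) (hq : 1 < q) (hd : 0 < d)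
    (hcard : Fintype.card F = q ^ d) {V : Submodule F (ι → F)} (hV : ∀ v ∈ V, φ ∘ v ∈ V)
    (f : (ι → F) →ₗ[F] F) (hf : ∀ v ∈ V, φ ∘ v = v → f v = 0) {v : ι → F} (hv : v ∈ V) :
    f v = 0 := by
  have key := eq_zero_of_forall_sum_frobenius_mul hφ hq hcard
    (c := fun i => f ((φ ^ i : F →+* F) ∘ v)) (fun x => ?_) hd
  · exact key
  · have hsum : cyclicTrace φ d ∘ (x • v) =
        ∑ i ∈ Finset.range d, (φ ^ i) x • ((φ ^ i : F →+* F) ∘ v) := by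
      ext k
      simp [cyclicTrace]
    have h0 : f (cyclicTrace φ d ∘ (x • v)) = 0 := by
      refine hf _ ?_ ?_
      · rw [hsum]
        exact Submodule.sum_mem _ fun i _ =>
          Submodule.smul_mem _ _ (pow_comp_mem_of_comp_mem hV i hv)
      · ext k
        exact map_cyclicTrace hφ hcard _
    rw [hsum, map_sum] at h0
    simpa using h0

/-- Vectors with entries in the fixed field of a Frobenius map which are independent over the
fixed field are independent. -/
theorem linearIndependent_of_fixed {F ι κ : Type*} [Field F] [Fintype F] {φ : F →+* F}
    {q d : ℕ} (hφ : ∀ x, φ x = x ^ q) (hq : 1 < q) (hd : 0 < d)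
    (hcard : Fintype.card F = q ^ d) {b : κ → ι → F} (hb : ∀ k, φ ∘ b k = b k)
    (hli : LinearIndependent (φ.eqLocusField (RingHom.id F)) b) : LinearIndependent F b := by
  rw [linearIndependent_iff'] at hli ⊢
  intro s g hg k hk
  refine eq_zero_of_forall_sum_frobenius_mul hφ hq hcard (c := fun i => (φ ^ i) (g k))
    (fun x => ?_) hd
  have hpow : ∀ i j l, (φ ^ i) (b j l) = b j l := by
    intro i j l
    induction i with
    | zero => rfl
    | succ i ih =>
      rw [pow_succ', RingHom.mul_def, RingHom.comp_apply, ih]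
      exact congrFun (hb j) l
  have := hli s (fun j => ⟨cyclicTrace φ d (x * g j), map_cyclicTrace hφ hcard _⟩) ?_ k hk
  · simpa [cyclicTrace] using congrArg Subtype.val this
  · ext l
    have hl := congrFun hg l
    simp only [Finset.sum_apply, Pi.smul_apply, smul_eq_mul, Pi.zero_apply] at hl
    simp only [Finset.sum_apply, Pi.smul_apply, Subfield.smul_def, smul_eq_mul, Pi.zero_apply,
      cyclicTrace, Finset.sum_mul]
    rw [Finset.sum_comm]
    refine Finset.sum_eq_zero fun i _ => ?_
    have : ∑ j ∈ s, (φ ^ i) (x * g j) * b j l = (φ ^ i) (x * ∑ j ∈ s, g j * b j l) := by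
      rw [Finset.mul_sum, map_sum]
      refine Finset.sum_congr rfl fun j _ => ?_
      rw [← mul_assoc, map_mul _ (x * g j), hpow]
    rw [this, hl, mul_zero, map_zero]

/-- Galois descent for finite fields: the fixed vectors of a Frobenius-stable subspace form a
space of the same dimension over the fixed field. -/
theorem card_fixed_eq_pow_finrank {F ι : Type*} [Field F] [Fintype F] [Finite ι] {φ : F →+* F}
    {q d : ℕ} (hφ : ∀ x, φ x = x ^ q) (hq : 1 < q) (hd : 0 < d)
    (hcard : Fintype.card F = q ^ d) {V : Submodule F (ι → F)} (hV : ∀ v ∈ V, φ ∘ v ∈ V) :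
    Nat.card {v | v ∈ V ∧ φ ∘ v = v} = q ^ Module.finrank F V := by
  classical
  let K := φ.eqLocusField (RingHom.id F)
  have hK : Nat.card K = q := by
    have hdvd : q - 1 ∣ Fintype.card F - 1 := by
      rw [hcard]
      simpa using Nat.sub_dvd_pow_sub_pow q 1 d
    rw [← card_filter_pow_eq_self hq hdvd]
    refine Nat.subtype_card _ fun x => ?_
    rw [Finset.mem_filter_univ, ← hφ]
    rfl
  let C : Submodule K (ι → F) :=
    { carrier := {v | v ∈ V ∧ φ ∘ v = v}
      zero_mem' := ⟨V.zero_mem, by ext; simp⟩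
      add_mem' := fun {v w} hv hw => ⟨V.add_mem hv.1 hw.1, by
        ext k
        simpa using congrArg₂ (· + ·) (congrFun hv.2 k) (congrFun hw.2 k)⟩
      smul_mem' := fun a v hv => ⟨V.smul_mem a.1 hv.1, by
        ext k
        have h1 : φ a.1 = a.1 := a.2
        have h2 : φ (v k) = v k := congrFun hv.2 k
        simp [Subfield.smul_def, h1, h2]⟩ }
  let b := Module.finBasis K C
  have hbC : ∀ k, (b k : ι → F) ∈ V ∧ φ ∘ (b k : ι → F) = b k := fun k => (b k).2
  have hli : LinearIndependent F (fun k => (b k : ι → F)) :=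
    linearIndependent_of_fixed hφ hq hd hcard (fun k => (hbC k).2)
      (b.linearIndependent.map' C.subtype C.ker_subtype)
  have hspan : Submodule.span F (Set.range fun k => (b k : ι → F)) = V := by
    apply le_antisymm
    · rw [Submodule.span_le]
      rintro _ ⟨k, rfl⟩
      exact (hbC k).1
    · intro v hv
      by_contra hnot
      obtain ⟨f, hfv, hle⟩ := Submodule.exists_le_ker_of_notMem hnot
      refine hfv (apply_eq_zero_of_forall_fixed hφ hq hd hcard hV f (fun w hw hw' => ?_) hv)
      have hsum := congrArg Subtype.val (b.sum_repr ⟨w, hw, hw'⟩)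
      simp only [Submodule.coe_sum, Submodule.coe_smul] at hsum
      rw [← hsum, map_sum]
      refine Finset.sum_eq_zero fun k _ => ?_
      have hk : f (b k) = 0 := hle (Submodule.subset_span ⟨k, rfl⟩)
      change f ((b.repr ⟨w, hw, hw'⟩ k).1 • (b k : ι → F)) = 0
      rw [map_smul, hk, smul_zero]
  have hfin : Module.finrank F V = Module.finrank K C := by
    rw [← hspan, finrank_span_eq_card hli, Fintype.card_fin]
  rw [hfin]
  have : Nat.card C = q ^ Module.finrank K C := by
    rw [← hK]
    exact Module.natCard_eq_pow_finrank
  exact this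

theorem eps_le_one {m : ℕ} (J : Finset (Fin m)) (j : Fin m) : eps J j ≤ 1 := by
  unfold eps
  split_ifs <;> omega

theorem evm_eq_monomialEval (F : Type) [Field F] [Fintype F] [DecidableEq F] {m : ℕ}
    (N : Fin m → ℕ) (J : Finset (Fin m)) (b : Fin m → ℕ) :
    evm F N J b = monomialEval (fun P : ↥(ZJ F N J) => P.1) b := rfl

theorem pow_sub_eps_eq {F : Type} [Field F] [Fintype F] [DecidableEq F] {m : ℕ}
    {N : Fin m → ℕ} {J : Finset (Fin m)} (P : ↥(ZJ F N J)) (j : Fin m) :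
    P.1 j ^ (N j - eps J j) = P.1 j ^ (1 - eps J j) := by
  have h := (Finset.mem_filter.1 P.2).2 j
  by_cases hj : j ∈ J
  · simpa [eps, hj] using h.1 hj
  · simpa [eps, hj] using h.2 hj

theorem evm_eps_ne_zero {F : Type} [Field F] [Fintype F] [DecidableEq F] {m : ℕ}
    {N : Fin m → ℕ} {J : Finset (Fin m)} (hN : ∀ j, 1 < N j) (P : ↥(ZJ F N J)) :
    evm F N J (eps J) P ≠ 0 := by
  refine Finset.prod_ne_zero_iff.2 fun j _ => ?_
  by_cases hj : j ∈ J
  · have h := ((Finset.mem_filter.1 P.2).2 j).1 hj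
    have hNj := hN j
    refine pow_ne_zero _ fun h0 => ?_
    rw [h0, zero_pow (by omega)] at h
    exact zero_ne_one h
  · simp [eps, hj]

/-- The exponents `b` with `ε_j ≤ b_j ≤ N_j - 1` for all `j`. -/
def exponentBox {m : ℕ} (N : Fin m → ℕ) (J : Finset (Fin m)) : Finset (Fin m → ℕ) :=
  Fintype.piFinset fun j => Finset.Icc (eps J j) (N j - 1)

theorem mem_exponentBox {m : ℕ} {N : Fin m → ℕ} {J : Finset (Fin m)} {b : Fin m → ℕ} :
    b ∈ exponentBox N J ↔ ∀ j, eps J j ≤ b j ∧ b j ≤ N j - 1 := by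
  simp [exponentBox]

theorem linearIndependent_evm (F : Type) [Field F] [Fintype F] [DecidableEq F] {m : ℕ}
    {N : Fin m → ℕ} {J : Finset (Fin m)} (hN : ∀ j, 1 < N j)
    (hdvd : ∀ j, N j - 1 ∣ Fintype.card F - 1) :
    LinearIndependent F (fun b : ↥(exponentBox N J) => evm F N J b.1) := by
  apply linearIndependent_of_top_le_span_of_card_eq_finrank
  · intro v _
    let u : ↥(ZJ F N J) → F := evm F N J (eps J)
    have hv : v = LinearMap.mulRight F u (v * u⁻¹) := by
      ext P
      simp [u, inv_mul_cancel_right₀ (evm_eps_ne_zero hN P)]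
    rw [hv]
    have hw : v * u⁻¹ ∈ (⊤ : Submodule F (↥(ZJ F N J) → F)) := trivial
    rw [← span_isStandardExponent (pt := fun P : ↥(ZJ F N J) => P.1) Subtype.val_injective] at hw
    refine (Submodule.span_le (p := (Submodule.span F
      (Set.range fun b : ↥(exponentBox N J) => evm F N J b.1)).comap
        (LinearMap.mulRight F u))).2 ?_ hw
    rintro _ ⟨b, hb, rfl⟩
    have hbox : b + eps J ∈ exponentBox N J := mem_exponentBox.2 fun j => by
      have h1 := eps_le_one J j
      have h2 := hN j
      have := hb.lt_of_pow_eq (j := j) (k := N j - eps J j) (l := 1 - eps J j) (by omega)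
        fun P => pow_sub_eps_eq P j
      rw [Pi.add_apply]
      omega
    refine Submodule.subset_span ⟨⟨_, hbox⟩, ?_⟩
    exact monomialEval_add _ _ _
  · rw [Module.finrank_pi, Fintype.card_coe, Fintype.card_coe, card_ZJ F J hN hdvd, exponentBox,
      Fintype.card_piFinset]
    refine Finset.prod_congr rfl fun j _ => ?_
    have h1 := hN j
    rw [Nat.card_Icc, Nat.sub_add_cancel h1.le]

/-- The footprint bound: a nonzero vector orthogonal to all `ev_J(X^b)`, `b ∈ N(J,t)`, has weight
at least `t`. -/
theorem le_card_support_of_orthogonal {F : Type} [Field F] [Fintype F] [DecidableEq F] {m : ℕ}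
    {N : Fin m → ℕ} {J : Finset (Fin m)} (hN : ∀ j, 1 < N j) {t : ℕ} {y : ↥(ZJ F N J) → F}
    (hy : ∀ b ∈ NSet N J t, ∑ i, evm F N J b i * y i = 0) (hy0 : y ≠ 0) :
    t ≤ (Finset.univ.filter fun i => y i ≠ 0).card := by
  by_contra! hlt
  let pt : {i : ↥(ZJ F N J) // y i ≠ 0} → Fin m → F := fun i => i.1.1
  have hpt : Function.Injective pt := Subtype.val_injective.comp Subtype.val_injective
  let u : {i : ↥(ZJ F N J) // y i ≠ 0} → F := fun i => evm F N J (eps J) i.1 * y i.1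
  let f : ({i : ↥(ZJ F N J) // y i ≠ 0} → F) →ₗ[F] F := ∑ i, u i • LinearMap.proj i
  have hf : ∀ v, f v = ∑ i, u i * v i := fun v => by simp [f]
  have hker : (⊤ : Submodule F _) ≤ LinearMap.ker f := by
    rw [← span_isStandardExponent hpt, Submodule.span_le]
    rintro _ ⟨b, hb, rfl⟩
    have hcard := hb.prod_le_card
    have hmem : b + eps J ∈ NSet N J t := by
      refine ⟨fun j => ?_, ?_⟩
      · have h1 := eps_le_one J j
        have h2 := hN j
        have := hb.lt_of_pow_eq (j := j) (k := N j - eps J j) (l := 1 - eps J j) (by omega)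
          fun P => pow_sub_eps_eq P.1 j
        rw [Pi.add_apply]
        omega
      · have : ∀ j, (b + eps J) j + 1 - eps J j = b j + 1 := fun j => by
          rw [Pi.add_apply]
          omega
        simp_rw [this]
        rw [Fintype.card_subtype] at hcard
        omega
    rw [SetLike.mem_coe, LinearMap.mem_ker, hf]
    refine Eq.trans ?_ (hy _ hmem)
    rw [← Finset.sum_subset (Finset.subset_univ (Finset.univ.filter fun i => y i ≠ 0)),
      Finset.sum_subtype (p := fun i => y i ≠ 0)]
    · refine Finset.sum_congr rfl fun i _ => ?_
      rw [evm_eq_monomialEval F N J (b + eps J), monomialEval_add, Pi.mul_apply]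
      change _ * _ * _ = evm F N J b i.1 * evm F N J (eps J) i.1 * y i.1
      change _ * evm F N J b i.1 = _
      ring
    · simp
    · intro i _ hi
      have : y i = 0 := by simpa using hi
      rw [this, mul_zero]
  obtain ⟨i, hi⟩ := Function.ne_iff.1 hy0
  have h1 : f (Pi.single ⟨i, hi⟩ 1) = 0 := hker (x := Pi.single ⟨i, hi⟩ 1) trivial
  rw [hf, Finset.sum_eq_single ⟨i, hi⟩ (fun k _ hk => by simp [hk]) (by simp)] at h1
  simp only [Pi.single_eq_same, mul_one] at h1
  exact mul_ne_zero (evm_eps_ne_zero hN i) hi h1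

theorem muMap_mem_exponentBox {m : ℕ} {N : Fin m → ℕ} {J : Finset (Fin m)} (hN : ∀ j, 1 < N j)
    (b₀ : ℕ) {b : Fin m → ℕ} (hb : b ∈ exponentBox N J) : muMap b₀ N b ∈ exponentBox N J := by
  rw [mem_exponentBox] at hb ⊢
  intro j
  have h1 := eps_le_one J j
  have h2 := hN j
  have h3 := hb j
  have h4 := Nat.mod_lt (b₀ * b j) (show 0 < N j - 1 by omega)
  unfold muMap
  split_ifs <;> omega

theorem DeltaSet_subset_exponentBox {m : ℕ} {N : Fin m → ℕ} {J : Finset (Fin m)}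
    (hN : ∀ j, 1 < N j) (b₀ t : ℕ) : DeltaSet b₀ N J t ⊆ exponentBox N J := by
  rintro _ ⟨b, hb, i, rfl⟩
  induction i with
  | zero => exact mem_exponentBox.2 hb.1
  | succ i ih =>
    rw [Function.iterate_succ_apply']
    exact muMap_mem_exponentBox hN b₀ ih

theorem muMap_mem_DeltaSet {m : ℕ} {N : Fin m → ℕ} {J : Finset (Fin m)} {b₀ t : ℕ}
    {c : Fin m → ℕ} (hc : c ∈ DeltaSet b₀ N J t) : muMap b₀ N c ∈ DeltaSet b₀ N J t := by
  obtain ⟨b, hb, i, rfl⟩ := hc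
  exact ⟨b, hb, i + 1, Function.iterate_succ_apply' _ _ _⟩

theorem pow_eq_one_of_mem_ZJ {F : Type} [Field F] [Fintype F] [DecidableEq F] {m : ℕ}
    {N : Fin m → ℕ} {J : Finset (Fin m)} (hN : ∀ j, 1 < N j) (P : ↥(ZJ F N J)) {j : Fin m}
    (h0 : P.1 j ≠ 0) : P.1 j ^ (N j - 1) = 1 := by
  have h := (Finset.mem_filter.1 P.2).2 j
  by_cases hj : j ∈ J
  · exact h.1 hj
  · have h2 := h.2 hj
    rw [← Nat.sub_add_cancel (hN j).le, pow_succ] at h2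
    exact (mul_eq_right₀ h0).1 h2

theorem evm_muMap {F : Type} [Field F] [Fintype F] [DecidableEq F] {m : ℕ}
    {N : Fin m → ℕ} {J : Finset (Fin m)} (hN : ∀ j, 1 < N j) {b₀ : ℕ} (hb₀ : b₀ ≠ 0)
    (b : Fin m → ℕ) (P : ↥(ZJ F N J)) :
    evm F N J (muMap b₀ N b) P = evm F N J b P ^ b₀ := by
  unfold evm
  rw [← Finset.prod_pow]
  refine Finset.prod_congr rfl fun j _ => ?_
  rw [← pow_mul]
  have hNj := hN j
  by_cases hb : b j = 0
  · simp [muMap, hb]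
  by_cases hP : P.1 j = 0
  · have : muMap b₀ N b j ≠ 0 := by
      unfold muMap
      split_ifs <;> omega
    rw [hP, zero_pow this, zero_pow (mul_ne_zero hb hb₀)]
  · have h1 := pow_eq_one_of_mem_ZJ hN P hP
    rw [mul_comm (b j), pow_eq_pow_mod (b₀ * b j) h1]
    simp only [muMap, if_neg hb]
    split_ifs with h
    · rw [h, h1, pow_zero]
    · rfl

theorem finrank_EDelta (F : Type) [Field F] [Fintype F] [DecidableEq F] {m : ℕ}
    {N : Fin m → ℕ} {J : Finset (Fin m)} (hN : ∀ j, 1 < N j)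
    (hdvd : ∀ j, N j - 1 ∣ Fintype.card F - 1) (b₀ t : ℕ) :
    Module.finrank F (EDelta F b₀ N J t) = Nat.card (DeltaSet b₀ N J t) := by
  have hsub := DeltaSet_subset_exponentBox (J := J) hN b₀ t
  have := ((exponentBox N J).finite_toSet.subset hsub).fintype
  have hli := (linearIndependent_evm F (J := J) hN hdvd).comp
    (fun c : DeltaSet b₀ N J t => ⟨c.1, hsub c.2⟩)
    (fun c d h => Subtype.ext (congrArg (fun e => e.1) h))
  rw [Nat.card_eq_fintype_card, ← finrank_span_eq_card hli, EDelta]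
  refine congrArg (fun S : Set _ => Module.finrank F (Submodule.span F S)) ?_
  ext v
  simp [eq_comm]

theorem comp_mem_EDelta {F : Type} [Field F] [Fintype F] [DecidableEq F] {m : ℕ}
    {N : Fin m → ℕ} {J : Finset (Fin m)} (hN : ∀ j, 1 < N j) {b₀ : ℕ} (hb₀ : b₀ ≠ 0) {t : ℕ}
    {φ : F →+* F} (hφ : ∀ x, φ x = x ^ b₀) {v : ↥(ZJ F N J) → F}
    (hv : v ∈ EDelta F b₀ N J t) : φ ∘ v ∈ EDelta F b₀ N J t := by
  induction hv using Submodule.span_induction with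
  | mem v hv =>
    obtain ⟨c, hc, rfl⟩ := hv
    refine Submodule.subset_span ⟨_, muMap_mem_DeltaSet hc, ?_⟩
    ext P
    rw [evm_muMap hN hb₀, Function.comp_apply, hφ]
  | zero =>
    convert (EDelta F b₀ N J t).zero_mem
    ext P
    simp
  | add v w _ _ hv hw =>
    convert (EDelta F b₀ N J t).add_mem hv hw
    ext P
    simp
  | smul a v _ hv =>
    convert (EDelta F b₀ N J t).smul_mem (φ a) hv
    ext P
    simp

theorem sum_mul_eq_zero_of_mem_EDelta {F : Type} [Field F] [Fintype F] [DecidableEq F] {m : ℕ}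
    {N : Fin m → ℕ} {J : Finset (Fin m)} {b₀ t : ℕ} {y : ↥(ZJ F N J) → F}
    (h : ∀ c ∈ DeltaSet b₀ N J t, ∑ i, evm F N J c i * y i = 0) {x : ↥(ZJ F N J) → F}
    (hx : x ∈ EDelta F b₀ N J t) : ∑ i, x i * y i = 0 := by
  induction hx using Submodule.span_induction with
  | mem v hv =>
    obtain ⟨c, hc, rfl⟩ := hv
    exact h c hc
  | zero => simp
  | add v w _ _ hv hw => simp only [Pi.add_apply, add_mul, Finset.sum_add_distrib, hv, hw, add_zero]
  | smul a v _ hv =>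
    simp only [Pi.smul_apply, smul_eq_mul, mul_assoc, ← Finset.mul_sum, hv, mul_zero]

/-- Theorem 9 of the paper. Euclidean self-orthogonality, dimension
and designed distance of the subfield-subcode over `F_{p^s}` of the `J`-affine variety
code given by `Δ = Δ(N(J,t))`. -/
theorem multivariate_subfield_subcode_euclidean
    (p r s m : ℕ) (hp : p.Prime) (hr : 0 < r) (hs : 0 < s) (hsr : s ∣ r)
    (F : Type) [Field F] [Fintype F] [DecidableEq F]
    (hF : Fintype.card F = p ^ r)
    (N : Fin m → ℕ) (hN : ∀ j, 1 < N j)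
    (hNdvd : ∀ j, (N j - 1) ∣ (Fintype.card F - 1))
    (J : Finset (Fin m)) (hpN : ∀ j ∉ J, p ∣ N j)
    (t : ℕ) (ht : 1 ≤ t) (htn : t ≤ ∏ j, (N j - eps J j))
    (hcompat : ∀ c ∈ DeltaSet (p ^ s) N J t, ∀ c' ∈ DeltaSet (p ^ s) N J t,
      ¬ ((∀ j, (N j - 1) ∣ (c j + c' j)) ∧ ∀ j ∉ J, 0 < c j + c' j)) :
    (∀ x ∈ sfcDelta F (p ^ s) (p ^ s) N J t, ∀ y ∈ sfcDelta F (p ^ s) (p ^ s) N J t,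
      ∑ i, x i * y i = 0) ∧
    Nat.card (sfcDelta F (p ^ s) (p ^ s) N J t) =
      (p ^ s) ^ (Nat.card (DeltaSet (p ^ s) N J t)) ∧
    (∀ y : ↥(ZJ F N J) → F,
      (∀ i, y i ^ (p ^ s) = y i) →
      (∀ x ∈ sfcDelta F (p ^ s) (p ^ s) N J t, ∑ i, x i * y i = 0) →
      y ≠ 0 →
      t ≤ (Finset.univ.filter (fun i => y i ≠ 0)).card) := by

  have : Fact p.Prime := ⟨hp⟩
  have : CharP F p := charP_of_card_eq_prime_pow hF
  obtain ⟨d, rfl⟩ := hsr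
  have hd : 0 < d := Nat.pos_of_mul_pos_left hr
  have hcard : Fintype.card F = (p ^ s) ^ d := by rw [hF, pow_mul]
  have hq : 1 < p ^ s := Nat.one_lt_pow hs.ne' hp.one_lt
  let φ : F →+* F := iterateFrobenius F p s
  have hφ : ∀ x, φ x = x ^ p ^ s := fun x => iterateFrobenius_def p s x
  have hV : ∀ v ∈ EDelta F (p ^ s) N J t, φ ∘ v ∈ EDelta F (p ^ s) N J t := fun v hv =>
    comp_mem_EDelta hN (by omega) hφ hv
  have hC : sfcDelta F (p ^ s) (p ^ s) N J t =
      {v | v ∈ EDelta F (p ^ s) N J t ∧ φ ∘ v = v} := by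
    ext v
    simp [sfcDelta, funext_iff, hφ]
  refine ⟨fun x hx y hy => ?_, ?_, fun y _ hyC hy0 => ?_⟩
  · refine sum_mul_eq_zero_of_mem_EDelta (fun c hc => ?_) hx.1
    simp_rw [mul_comm _ (y _)]
    refine sum_mul_eq_zero_of_mem_EDelta (fun c' hc' => ?_) hy.1
    exact sum_evm_mul_evm_eq_zero (p := p) hN hNdvd hpN (hcompat c' hc' c hc)
  · rw [hC, card_fixed_eq_pow_finrank hφ hq hd hcard hV, finrank_EDelta F hN hNdvd]
  · refine le_card_support_of_orthogonal hN (fun b hb => ?_) hy0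
    let f : (↥(ZJ F N J) → F) →ₗ[F] F := ∑ i, y i • LinearMap.proj i
    have hf : ∀ v, f v = ∑ i, v i * y i := fun v => by simp [f, mul_comm]
    rw [← hf]
    refine apply_eq_zero_of_forall_fixed hφ hq hd hcard hV f (fun v hv hv' => ?_)
      (Submodule.subset_span ⟨b, ⟨b, hb, 0, rfl⟩, rfl⟩)
    rw [hf]
    exact hyC v (hC ▸ ⟨hv, hv'⟩)
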